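/- arXiv:1905.02309 — 2 statements merged into one kernel-verified Lean document; each statement's English description precedes it below -/
import Mathlib

section
/- Let T be a nonempty set of sum indecomposable permutation patterns. Then the sequence |Av_n(T)|^{1/n} converges in the extended nonnegative reals [0,∞], and its limit equals sup_{n ≥ 1} |Av_n(T)|^{1/n}. -/
open Filter Topology
open scoped ENNReal

/-- `σ ∈ S_n` contains the pattern `τ ∈ S_m`. -/
def PermContains {n m : ℕ} (σ : Equiv.Perm (Fin n)) (τ : Equiv.Perm (Fin m)) : Prop :=
  ∃ f : Fin m → Fin n, StrictMono f ∧ ∀ j k : Fin m, σ (f j) < σ (f k) ↔ τ j < τ k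

/-- `σ` avoids every pattern in the set `T`. -/
def AvoidsAll {n : ℕ} (σ : Equiv.Perm (Fin n)) (T : Set (Σ m, Equiv.Perm (Fin m))) : Prop :=
  ∀ τ ∈ T, ¬ PermContains σ τ.2

/-- The direct sum `λ ⊕ μ` of two permutations. -/
def directSum {l m : ℕ} (lam : Equiv.Perm (Fin l)) (mu : Equiv.Perm (Fin m)) :
    Equiv.Perm (Fin (l + m)) :=
  finSumFinEquiv.symm.trans ((Equiv.sumCongr lam mu).trans finSumFinEquiv)

/-- A permutation is sum indecomposable if it is not a direct sum of two shorter permutations. -/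
def SumIndecomposable {n : ℕ} (σ : Equiv.Perm (Fin n)) : Prop :=
  ¬ ∃ (l m : ℕ) (_ : 0 < l) (_ : 0 < m) (lam : Equiv.Perm (Fin l)) (mu : Equiv.Perm (Fin m))
      (h : l + m = n), σ = h ▸ directSum lam mu

/-- `σ ∈ S_n` is the permutation associated to a `k`-ary heap: in 1-indexed terms,
`σ(⌈(i−1)/k⌉) < σ(i)` for all `2 ≤ i ≤ n`; here `i : Fin n` is the 0-indexed vertex,
whose 0-indexed parent is `(i−1)/k` (floor division). -/
def IsHeapPerm (k : ℕ) {n : ℕ} (σ : Equiv.Perm (Fin n)) : Prop :=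
  ∀ i : Fin n, 1 ≤ (i : ℕ) →
    σ ⟨((i : ℕ) - 1) / k,
        lt_of_le_of_lt (le_trans (Nat.div_le_self _ _) (Nat.sub_le _ _)) i.isLt⟩ < σ i

/-- `|Av_n(T)|`. -/
noncomputable def avCount (T : Set (Σ m, Equiv.Perm (Fin m))) (n : ℕ) : ℕ :=
  Nat.card {σ : Equiv.Perm (Fin n) // AvoidsAll σ T}

/-- `|H_n^k(T)|`. -/
noncomputable def heapCount (k : ℕ) (T : Set (Σ m, Equiv.Perm (Fin m))) (n : ℕ) : ℕ :=
  Nat.card {σ : Equiv.Perm (Fin n) // IsHeapPerm k σ ∧ AvoidsAll σ T}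

@[simp]
theorem directSum_castAdd {l m : ℕ} (lam : Equiv.Perm (Fin l)) (mu : Equiv.Perm (Fin m))
    (i : Fin l) : directSum lam mu (Fin.castAdd m i) = Fin.castAdd m (lam i) := by
  simp [directSum]

@[simp]
theorem directSum_natAdd {l m : ℕ} (lam : Equiv.Perm (Fin l)) (mu : Equiv.Perm (Fin m))
    (i : Fin m) : directSum lam mu (Fin.natAdd l i) = Fin.natAdd l (mu i) := by
  simp [directSum]

theorem directSum_injective {l m : ℕ} :
    Function.Injective fun p : Equiv.Perm (Fin l) × Equiv.Perm (Fin m) =>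
      directSum p.1 p.2 := by
  rintro ⟨lam, mu⟩ ⟨lam', mu'⟩ h
  refine Prod.ext (Equiv.ext fun i => ?_) (Equiv.ext fun i => ?_)
  · simpa using DFunLike.congr_fun h (Fin.castAdd m i)
  · simpa using DFunLike.congr_fun h (Fin.natAdd l i)

theorem PermContains.trans {l m n : ℕ} {ρ : Equiv.Perm (Fin l)} {σ : Equiv.Perm (Fin m)}
    {τ : Equiv.Perm (Fin n)} (h₁ : PermContains ρ σ) (h₂ : PermContains σ τ) :
    PermContains ρ τ := by
  obtain ⟨f, hf, hf'⟩ := h₁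
  obtain ⟨g, hg, hg'⟩ := h₂
  exact ⟨f ∘ g, hf.comp hg, fun j k => (hf' _ _).trans (hg' _ _)⟩

theorem AvoidsAll.of_permContains {m n : ℕ} {T : Set (Σ m, Equiv.Perm (Fin m))}
    {σ : Equiv.Perm (Fin n)} {ρ : Equiv.Perm (Fin m)} (hσ : AvoidsAll σ T)
    (h : PermContains σ ρ) : AvoidsAll ρ T :=
  fun τ hτ hc => hσ τ hτ (h.trans hc)

/-- If a permutation of `Fin (a + b)` sends the first `a` positions below the last `b` ones, it is
a direct sum. -/
theorem exists_eq_directSum {a b : ℕ} (τ : Equiv.Perm (Fin (a + b)))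
    (h : ∀ (i : Fin a) (j : Fin b), τ (Fin.castAdd b i) < τ (Fin.natAdd a j)) :
    ∃ (lam : Equiv.Perm (Fin a)) (mu : Equiv.Perm (Fin b)), τ = directSum lam mu := by
  have hlt (i : Fin a) : (τ (Fin.castAdd b i) : ℕ) < a := by
    have hsub : (Finset.univ.image (τ ∘ Fin.natAdd a)) ⊆
        Finset.Ioi (τ (Fin.castAdd b i)) := by
      intro x hx
      obtain ⟨j, -, rfl⟩ := Finset.mem_image.1 hx
      exact Finset.mem_Ioi.2 (h i j)
    have hcard := Finset.card_le_card hsub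
    rw [Finset.card_image_of_injective _ (τ.injective.comp (Fin.natAdd_injective b a)),
      Fin.card_Ioi, Finset.card_univ, Fintype.card_fin] at hcard
    have := (τ (Fin.castAdd b i)).isLt
    omega
  let e : Equiv.Perm (Fin a ⊕ Fin b) := finSumFinEquiv.trans (τ.trans finSumFinEquiv.symm)
  have he : e ∈ (Equiv.Perm.sumCongrHom (Fin a) (Fin b)).range := by
    apply Equiv.Perm.mem_sumCongrHom_range_of_perm_mapsTo_inl
    rintro _ ⟨i, rfl⟩
    refine ⟨⟨_, hlt i⟩, ?_⟩
    apply finSumFinEquiv.injective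
    simp [e]
  obtain ⟨⟨lam, mu⟩, hp⟩ := he
  refine ⟨lam, mu, Equiv.ext fun x => ?_⟩
  have hx := DFunLike.congr_fun hp (finSumFinEquiv.symm x)
  apply finSumFinEquiv.symm.injective
  simpa [e, directSum] using hx.symm

theorem SumIndecomposable.exists_not_lt {n : ℕ} {τ : Equiv.Perm (Fin n)}
    (hτ : SumIndecomposable τ) {k : ℕ} (hk : 0 < k) (hkn : k < n) :
    ∃ i j : Fin n, (i : ℕ) < k ∧ k ≤ j ∧ ¬ τ i < τ j := by
  by_contra! hlt
  obtain ⟨b, rfl⟩ := Nat.exists_eq_add_of_lt hkn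
  obtain ⟨lam, mu, h⟩ := exists_eq_directSum (a := k) (b := b + 1) τ
    fun i j => hlt _ _ (by simp) (by simp)
  exact hτ ⟨k, b + 1, hk, b.succ_pos, lam, mu, rfl, h⟩

theorem PermContains.of_directSum {l m n : ℕ} {lam : Equiv.Perm (Fin l)}
    {mu : Equiv.Perm (Fin m)} {τ : Equiv.Perm (Fin n)} (hτ : SumIndecomposable τ)
    (h : PermContains (directSum lam mu) τ) : PermContains lam τ ∨ PermContains mu τ := by
  obtain ⟨f, hf, hfτ⟩ := h
  by_cases hl : ∀ j, (f j : ℕ) < l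
  · refine Or.inl ⟨fun j => ⟨f j, hl j⟩, fun i j hij => hf hij, fun j k => ?_⟩
    have hj (j : Fin n) : f j = Fin.castAdd m ⟨f j, hl j⟩ := rfl
    rw [← hfτ, hj j, hj k, directSum_castAdd, directSum_castAdd]
    rfl
  by_cases hr : ∀ j, l ≤ (f j : ℕ)
  · have hj (j : Fin n) : ∃ g : Fin m, f j = Fin.natAdd l g :=
      ⟨⟨f j - l, by have := (f j).isLt; have := hr j; omega⟩, by ext; simp [hr j]⟩
    choose g hg using hj
    refine Or.inr ⟨g, fun i j hij => ?_, fun j k => ?_⟩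
    · simpa [hg] using hf hij
    · rw [← hfτ, hg, hg, directSum_natAdd, directSum_natAdd]
      simp
  · exfalso
    push Not at hl hr
    obtain ⟨p, hp⟩ := hl
    obtain ⟨q, hq⟩ := hr
    have hex : ∃ k : ℕ, ∃ h : k < n, l ≤ (f ⟨k, h⟩ : ℕ) := ⟨p, p.isLt, hp⟩
    classical
    obtain ⟨hkn, hk⟩ := Nat.find_spec hex
    have hlow (i : Fin n) (hi : (i : ℕ) < Nat.find hex) : (f i : ℕ) < l := by
      by_contra! hc
      exact Nat.find_min hex hi ⟨i.isLt, hc⟩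
    have hhigh (j : Fin n) (hj : Nat.find hex ≤ j) : l ≤ (f j : ℕ) :=
      hk.trans (hf.monotone (show (⟨Nat.find hex, hkn⟩ : Fin n) ≤ j from hj))
    have hpos : 0 < Nat.find hex := by
      by_contra! hc
      have := hhigh q (by omega)
      omega
    obtain ⟨i, j, hi, hj, hij⟩ := hτ.exists_not_lt hpos hkn
    refine hij ((hfτ i j).1 ?_)
    have h₁ : f i = Fin.castAdd m ⟨f i, hlow i hi⟩ := rfl
    have h₂ : f j = Fin.natAdd l ⟨f j - l, by have := (f j).isLt; have := hhigh j hj; omega⟩ := by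
      ext; simp [hhigh j hj]
    rw [h₁, h₂, directSum_castAdd, directSum_natAdd, Fin.lt_def, Fin.val_castAdd, Fin.val_natAdd]
    exact (Fin.isLt _).trans_le (Nat.le_add_right _ _)

theorem avCount_mul_le {T : Set (Σ m, Equiv.Perm (Fin m))}
    (hT : ∀ τ ∈ T, SumIndecomposable τ.2) (m n : ℕ) :
    avCount T m * avCount T n ≤ avCount T (m + n) := by
  rw [avCount, avCount, avCount, ← Nat.card_prod]
  refine Nat.card_le_card_of_injective (fun p => ⟨directSum p.1.1 p.2.1, fun τ hτ hc =>
    (hc.of_directSum (hT τ hτ)).elim (p.1.2 τ hτ) (p.2.2 τ hτ)⟩) fun p q hpq => ?_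
  have := directSum_injective (a₁ := (p.1.1, p.2.1)) (a₂ := (q.1.1, q.2.1))
    (congrArg Subtype.val hpq)
  exact Prod.ext (Subtype.ext (congrArg Prod.fst this)) (Subtype.ext (congrArg Prod.snd this))

theorem avCount_eq_zero_of_one {T : Set (Σ m, Equiv.Perm (Fin m))} (h : avCount T 1 = 0)
    {n : ℕ} (hn : n ≠ 0) : avCount T n = 0 := by
  rw [avCount, Finite.card_eq_zero_iff] at h ⊢
  refine ⟨fun σ => h.elim ⟨1, σ.2.of_permContains ?_⟩⟩
  exact ⟨fun _ => ⟨0, Nat.pos_of_ne_zero hn⟩, Subsingleton.strictMono _, fun j k => by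
    simp [Subsingleton.elim j k]⟩

/-- Fekete's lemma for supermultiplicative sequences of positive integers, with no boundedness
assumption. -/
theorem tendsto_rpow_one_div_of_supermultiplicative {a : ℕ → ℕ} (hpos : ∀ n, n ≠ 0 → 0 < a n)
    (ha : ∀ m n, a m * a n ≤ a (m + n)) :
    Tendsto (fun n : ℕ => (a n : ℝ≥0∞) ^ (1 / (n : ℝ))) atTop
      (𝓝 (⨆ n : ℕ, ⨆ _ : 1 ≤ n, (a n : ℝ≥0∞) ^ (1 / (n : ℝ)))) := by
  have hlog {m n : ℕ} (hm : m ≠ 0) (hn : n ≠ 0) :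
      Real.log (a m) + Real.log (a n) ≤ Real.log (a (m + n)) := by
    have hm' : (0 : ℝ) < a m := by exact_mod_cast hpos m hm
    have hn' : (0 : ℝ) < a n := by exact_mod_cast hpos n hn
    rw [← Real.log_mul hm'.ne' hn'.ne']
    exact Real.log_le_log (by positivity) (by exact_mod_cast ha m n)
  have hzero : Real.log (a 0) = 0 := by
    have h₀ : a 0 ≤ 1 := by
      have h := ha 0 1
      rw [zero_add] at h
      exact le_of_mul_le_mul_right (by simpa using h) (hpos 1 one_ne_zero)
    interval_cases a 0 <;> simp
  have hsub : Subadditive fun n => -Real.log (a n) := by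
    intro m n
    rcases eq_or_ne m 0 with rfl | hm
    · simp [hzero]
    rcases eq_or_ne n 0 with rfl | hn
    · simp [hzero]
    linarith [hlog hm hn]
  have hexp {n : ℕ} (hn : n ≠ 0) : (a n : ℝ≥0∞) ^ (1 / (n : ℝ)) =
      ENNReal.ofReal (Real.exp (-(-Real.log (a n) / n))) := by
    have hn' : (0 : ℝ) < a n := by exact_mod_cast hpos n hn
    rw [← ENNReal.ofReal_natCast, ENNReal.ofReal_rpow_of_pos hn', Real.rpow_def_of_pos hn']
    congr 2
    ring
  refine tendsto_order.2 ⟨fun x hx => ?_, fun x hx => ?_⟩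
  · obtain ⟨n, hn, hxn⟩ : ∃ n, ∃ _ : 1 ≤ n, x < (a n : ℝ≥0∞) ^ (1 / (n : ℝ)) := by
      simpa only [lt_iSup_iff] using hx
    have hn₀ : n ≠ 0 := by omega
    have hxt : x ≠ ⊤ := hxn.ne_top
    rw [hexp hn₀, ENNReal.lt_ofReal_iff_toReal_lt hxt] at hxn
    rcases ENNReal.toReal_nonneg.eq_or_lt' with hx₀ | hx₀
    · filter_upwards [eventually_ne_atTop 0] with p hp
      rw [hexp hp, ENNReal.lt_ofReal_iff_toReal_lt hxt, hx₀]
      exact Real.exp_pos _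
    · have hlt : -Real.log (a n) / n < -Real.log x.toReal := by
        linarith [(Real.log_lt_iff_lt_exp hx₀).2 hxn]
      filter_upwards [hsub.eventually_div_lt_of_div_lt hn₀ hlt, eventually_ne_atTop 0] with p hp hp₀
      rw [hexp hp₀, ENNReal.lt_ofReal_iff_toReal_lt hxt, ← Real.log_lt_iff_lt_exp hx₀]
      linarith
  · filter_upwards [eventually_ge_atTop 1] with n hn
    exact (le_iSup₂ (f := fun (n : ℕ) (_ : 1 ≤ n) => (a n : ℝ≥0∞) ^ (1 / (n : ℝ))) n hn).trans_lt hx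

/-- **Fekete's lemma for pattern classes.** For a nonempty set `T` of sum indecomposable
patterns, `|Av_n(T)|^{1/n}` converges in `[0,∞]` to `sup_{n ≥ 1} |Av_n(T)|^{1/n}`. -/
theorem av_growth_exists (T : Set (Σ m, Equiv.Perm (Fin m))) (hne : T.Nonempty)
    (hT : ∀ τ ∈ T, SumIndecomposable τ.2) :
    Tendsto (fun n : ℕ => (avCount T n : ℝ≥0∞) ^ (1 / (n : ℝ))) atTop
      (𝓝 (⨆ n : ℕ, ⨆ _ : 1 ≤ n, (avCount T n : ℝ≥0∞) ^ (1 / (n : ℝ)))) := by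
  by_cases h₁ : avCount T 1 = 0
  · have hzero (n : ℕ) (hn : 1 ≤ n) : (avCount T n : ℝ≥0∞) ^ (1 / (n : ℝ)) = 0 := by
      rw [avCount_eq_zero_of_one h₁ (by omega), Nat.cast_zero, ENNReal.zero_rpow_of_pos]
      positivity
    rw [show (⨆ n : ℕ, ⨆ _ : 1 ≤ n, (avCount T n : ℝ≥0∞) ^ (1 / (n : ℝ))) = 0 from
      le_antisymm (iSup₂_le fun n hn => (hzero n hn).le) zero_le]
    exact tendsto_const_nhds.congr' ((eventually_ge_atTop 1).mono fun n hn => (hzero n hn).symm)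
  · refine tendsto_rpow_one_div_of_supermultiplicative (fun n hn => ?_) (avCount_mul_le hT)
    induction n with
    | zero => exact absurd rfl hn
    | succ n ih =>
      rcases eq_or_ne n 0 with rfl | hn'
      · exact Nat.pos_of_ne_zero h₁
      · exact (Nat.mul_pos (ih hn') (Nat.pos_of_ne_zero h₁)).trans_le (avCount_mul_le hT n 1)
end

section
/- For all integers t ≥ 1, the number of linear extensions of N_{3,t} that avoid the pattern 1243 is t(3t−1)/2. -/
open Polynomial

/-- The pattern `1243` (0-indexed). -/
def pat1243 : Equiv.Perm (Fin 4) := ⟨![0, 1, 3, 2], ![0, 1, 3, 2], by decide, by decide⟩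

/-- The pattern `2143` (0-indexed). -/
def pat2143 : Equiv.Perm (Fin 4) := ⟨![1, 0, 3, 2], ![1, 0, 3, 2], by decide, by decide⟩

/-- `w ∈ S_{st}` (a word recorded as a permutation of `Fin (s*t)`, positions and labels both
0-indexed, 0-indexed label `a` standing for the poset label `a+1`) encodes a linear extension
of the rectangular poset `N_{s,t}`: for every label `a ∈ [st]`, if `t ∤ a` then `a` appears
before `a+1`, and if `a > t` then `a` appears before `a−t`.  ("`a` appears before `b`" means
`w.symm a < w.symm b`.) -/
def IsLinExtN (s t : ℕ) (w : Equiv.Perm (Fin (s * t))) : Prop :=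
  (∀ a b : Fin (s * t), (b : ℕ) = (a : ℕ) + 1 → ¬ (t ∣ ((a : ℕ) + 1)) →
      w.symm a < w.symm b) ∧
  (∀ a b : Fin (s * t), (b : ℕ) + t = (a : ℕ) → w.symm a < w.symm b)

/-- The number of inversions of `w`. -/
def invCount {n : ℕ} (w : Equiv.Perm (Fin n)) : ℕ :=
  (Finset.univ.filter fun p : Fin n × Fin n => p.1 < p.2 ∧ w p.2 < w p.1).card

open Classical in
/-- The polynomial `N_{s,t}(τ)(q) = Σ_{w ∈ N_{s,t}(τ)} q^{inv(w)}`. -/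
noncomputable def NPoly (s t : ℕ) {m : ℕ} (τ : Equiv.Perm (Fin m)) : Polynomial ℤ :=
  ∑ w ∈ Finset.univ.filter
      (fun w : Equiv.Perm (Fin (s * t)) => IsLinExtN s t w ∧ ¬ PermContains w τ),
    (X : Polynomial ℤ) ^ invCount w

/-- The position of the label `a` in the word `w`, as a function on natural numbers. -/
def labelPos {n : ℕ} (w : Equiv.Perm (Fin n)) (a : ℕ) : ℕ :=
  if h : a < n then (w.symm ⟨a, h⟩ : ℕ) else a

lemma labelPos_of_lt {n : ℕ} (w : Equiv.Perm (Fin n)) {a : ℕ} (h : a < n) :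
    labelPos w a = w.symm ⟨a, h⟩ := dif_pos h

lemma labelPos_val {n : ℕ} (w : Equiv.Perm (Fin n)) (a : Fin n) :
    labelPos w a = w.symm a := labelPos_of_lt w a.isLt

lemma labelPos_lt {n : ℕ} (w : Equiv.Perm (Fin n)) {a : ℕ} (h : a < n) : labelPos w a < n := by
  rw [labelPos_of_lt w h]; exact Fin.isLt _

lemma labelPos_inj {n : ℕ} (w : Equiv.Perm (Fin n)) {a b : ℕ} (ha : a < n) (hb : b < n)
    (h : labelPos w a = labelPos w b) : a = b := by
  rw [labelPos_of_lt w ha, labelPos_of_lt w hb] at h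
  simpa using w.symm.injective (Fin.ext h)

/-- `q` lists the labels of `N_{3,t}` compatibly with the rows and columns of the poset. -/
structure RespectsThreeRows (t : ℕ) (q : ℕ → ℕ) : Prop where
  low : ∀ a b, a < b → b < t → q a < q b
  mid : ∀ a b, t ≤ a → a < b → b < 2 * t → q a < q b
  top : ∀ a b, 2 * t ≤ a → a < b → b < 3 * t → q a < q b
  col : ∀ a, a + t < 3 * t → q (a + t) < q a

lemma lt_of_forall_succ_lt {q : ℕ → ℕ} {l u : ℕ} (h : ∀ a, l ≤ a → a + 1 < u → q a < q (a + 1))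
    {a b : ℕ} (ha : l ≤ a) (hab : a < b) (hb : b < u) : q a < q b := by
  induction b, hab using Nat.le_induction with
  | base => exact h a ha hb
  | succ b hab ih =>
    have h₁ := ih (by omega)
    have h₂ := h b (by omega) hb
    omega

lemma isLinExtN_three_iff {t : ℕ} (w : Equiv.Perm (Fin (3 * t))) :
    IsLinExtN 3 t w ↔ RespectsThreeRows t (labelPos w) := by
  constructor
  · rintro ⟨hrow, hcol⟩
    have hstep : ∀ a, a + 1 < 3 * t → ¬ t ∣ a + 1 → labelPos w a < labelPos w (a + 1) := by
      intro a ha hd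
      rw [labelPos_of_lt w ha, labelPos_of_lt w (show a < 3 * t by omega)]
      exact hrow ⟨a, by omega⟩ ⟨a + 1, ha⟩ rfl hd
    have hnd : ∀ k a, k * t < a → a < (k + 1) * t → ¬ t ∣ a := by
      rintro k a h₁ h₂ ⟨m, rfl⟩
      rw [mul_comm t m] at h₁ h₂
      have := lt_of_mul_lt_mul_right h₁ (Nat.zero_le t)
      have := lt_of_mul_lt_mul_right h₂ (Nat.zero_le t)
      omega
    refine ⟨fun a b hab hb => ?_, fun a b ha hab hb => ?_, fun a b ha hab hb => ?_,
      fun a ha => ?_⟩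
    · exact lt_of_forall_succ_lt (l := 0) (u := t)
        (fun a _ hu => hstep a (by omega) (hnd 0 _ (by omega) (by omega))) (by omega) hab hb
    · exact lt_of_forall_succ_lt (l := t) (u := 2 * t)
        (fun a hl hu => hstep a (by omega) (hnd 1 _ (by omega) (by omega))) ha hab hb
    · exact lt_of_forall_succ_lt (l := 2 * t) (u := 3 * t)
        (fun a hl hu => hstep a (by omega) (hnd 2 _ (by omega) (by omega))) ha hab hb
    · rw [labelPos_of_lt w ha, labelPos_of_lt w (show a < 3 * t by omega)]
      exact hcol ⟨a + t, ha⟩ ⟨a, by omega⟩ rfl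
  · intro h
    refine ⟨fun a b hab hd => ?_, fun a b hab => ?_⟩
    · rw [Fin.lt_def, ← labelPos_val, ← labelPos_val]
      have hb := b.isLt
      have h₁ : (a : ℕ) + 1 ≠ t := fun e => hd ⟨1, by omega⟩
      have h₂ : (a : ℕ) + 1 ≠ 2 * t := fun e => hd ⟨2, by omega⟩
      rcases lt_or_ge (b : ℕ) t with hbt | hbt
      · exact h.low _ _ (by omega) hbt
      rcases lt_or_ge (b : ℕ) (2 * t) with hbt' | hbt'
      · exact h.mid _ _ (by omega) (by omega) hbt'
      · exact h.top _ _ (by omega) (by omega) hb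
    · rw [Fin.lt_def, ← labelPos_val, ← labelPos_val, ← hab]
      exact h.col b (by omega)

/-- All top-row labels precede all middle-row labels but the first, and all middle-row labels
precede all low-row labels but the first. -/
structure IsAlmostSorted (t : ℕ) (q : ℕ → ℕ) : Prop where
  top_mid : ∀ a b, 2 * t ≤ a → a < 3 * t → t < b → b < 2 * t → q a < q b
  mid_low : ∀ a b, t ≤ a → a < 2 * t → 0 < b → b < t → q a < q b

lemma permContains_pat1243_iff {n : ℕ} (w : Equiv.Perm (Fin n)) :
    PermContains w pat1243 ↔ ∃ a b c d, a < b ∧ b < c ∧ c < d ∧ d < n ∧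
      labelPos w a < labelPos w b ∧ labelPos w b < labelPos w d ∧
      labelPos w d < labelPos w c := by
  constructor
  · rintro ⟨f, hf, h⟩
    have key : ∀ i, labelPos w (w (f i)) = f i := fun i => by simp [labelPos_val]
    refine ⟨w (f 0), w (f 1), w (f 3), w (f 2), (h 0 1).2 (by decide), (h 1 3).2 (by decide),
      (h 3 2).2 (by decide), Fin.isLt _, ?_, ?_, ?_⟩ <;> rw [key, key] <;>
      exact hf (by decide)
  · rintro ⟨a, b, c, d, hab, hbc, hcd, hd, h₁, h₂, h₃⟩
    rw [labelPos_of_lt w (by omega), labelPos_of_lt w (by omega)] at h₁ h₂ h₃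
    refine ⟨![w.symm ⟨a, by omega⟩, w.symm ⟨b, by omega⟩, w.symm ⟨d, by omega⟩,
      w.symm ⟨c, by omega⟩], ?_, ?_⟩
    · rw [Fin.strictMono_iff_lt_succ]
      intro i
      fin_cases i
      · exact h₁
      · exact h₂
      · exact h₃
    · intro j k
      fin_cases j <;> fin_cases k <;> simp [pat1243] <;> omega

lemma isAlmostSorted_iff_avoids {t : ℕ} {w : Equiv.Perm (Fin (3 * t))}
    (h : RespectsThreeRows t (labelPos w)) :
    IsAlmostSorted t (labelPos w) ↔ ¬ PermContains w pat1243 := by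
  rw [permContains_pat1243_iff]
  constructor
  · rintro hs ⟨a, b, c, d, hab, hbc, hcd, hd, h₁, h₂, h₃⟩
    rcases lt_or_ge b t with hb | hb
    · rcases lt_or_ge c t with hc | hc
      · rcases lt_or_ge d t with hd' | hd'
        · have := h.low c d hcd hd'
          omega
        rcases lt_or_ge d (2 * t) with hd'' | hd''
        · have := hs.mid_low d b hd' hd'' (by omega) hb
          omega
        · have h₄ := hs.mid_low (d - t) b (by omega) (by omega) (by omega) hb
          have h₅ := h.col (d - t) (by omega)
          rw [show d - t + t = d by omega] at h₅
          omega
      rcases lt_or_ge c (2 * t) with hc' | hc'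
      · have := hs.mid_low c b hc hc' (by omega) hb
        omega
      · have := h.top c d hc' hcd hd
        omega
    · rcases lt_or_ge c (2 * t) with hc' | hc'
      · rcases lt_or_ge d (2 * t) with hd'' | hd''
        · have := h.mid c d (by omega) hcd hd''
          omega
        rcases eq_or_lt_of_le hb with rfl | hb'
        · have h₄ := h.col 0 (by omega)
          rw [zero_add] at h₄
          rcases Nat.eq_zero_or_pos a with rfl | ha
          · omega
          · have := h.low 0 a ha hab
            omega
        · have := hs.top_mid d b hd'' hd hb' (by omega)
          omega
      · have := h.top c d hc' hcd hd
        omega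
  · intro hav
    refine ⟨fun a b ha ha' hb hb' => ?_, fun a b ha ha' hb hb' => ?_⟩
    · by_contra hlt
      have hne : labelPos w a ≠ labelPos w b := fun e => by
        have := labelPos_inj w (by omega) (by omega) e
        omega
      have hlast : labelPos w a < labelPos w (2 * t - 1) := by
        have h₄ := h.col (2 * t - 1) (by omega)
        rcases eq_or_lt_of_le (show a ≤ 2 * t - 1 + t by omega) with e | e
        · rwa [← e] at h₄
        · have := h.top a _ ha e (by omega)
          omega
      rcases eq_or_lt_of_le (show b ≤ 2 * t - 1 by omega) with rfl | e
      · exact hlt hlast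
      · exact hav ⟨t, b, 2 * t - 1, a, hb, e, by omega, ha',
          h.mid t b le_rfl hb hb', by omega, hlast⟩
    · by_contra hlt
      have hne : labelPos w a ≠ labelPos w b := fun e => by
        have := labelPos_inj w (by omega) (by omega) e
        omega
      have hlast : labelPos w a < labelPos w (t - 1) := by
        have h₄ := h.col (t - 1) (by omega)
        rcases eq_or_lt_of_le (show a ≤ t - 1 + t by omega) with e | e
        · rwa [← e] at h₄
        · have := h.mid a _ ha e (by omega)
          omega
      rcases eq_or_lt_of_le (show b ≤ t - 1 by omega) with rfl | e
      · exact hlt hlast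
      · exact hav ⟨0, b, t - 1, a, hb, e, by omega, by omega,
          h.low 0 b hb hb', by omega, hlast⟩

/-- The label in place `i` of the word `2t, …, 3t-1, t+1, …, 2t-1, 1, …, t-1`. -/
def sortedLabel (t i : ℕ) : ℕ :=
  if i < t then 2 * t + i else if i < 2 * t - 1 then i + 1 else i + 2 - 2 * t

/-- The order embedding of `ℕ` into itself that skips the value `b`. -/
def skipValue (b r : ℕ) : ℕ := if r < b then r else r + 1

lemma skipValue_ne (b r : ℕ) : skipValue b r ≠ b := by
  unfold skipValue; split_ifs <;> omega

lemma skipValue_strictMono (b : ℕ) : StrictMono (skipValue b) := by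
  intro r s h
  unfold skipValue; split_ifs <;> omega

/-- The place of the label `x ≠ 0, t` in the word `2t, …, 3t-1, t+1, …, 2t-1, 1, …, t-1`. -/
def sortedRank (t x : ℕ) : ℕ :=
  if 2 * t ≤ x then x - 2 * t else if t < x then x - 1 else 2 * t + x - 2

/-- The position of the label `x` in the word obtained from
`2t, …, 3t-1, t+1, …, 2t-1, 1, …, t-1` by inserting `t` at position `b` and then `0` at
position `c`. -/
def insertedPos (t b c x : ℕ) : ℕ :=
  if x = t then b else if x = 0 then c else skipValue c (skipValue b (sortedRank t x))

lemma insertedPos_of_ne {t b c x : ℕ} (hxt : x ≠ t) (hx₀ : x ≠ 0) :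
    insertedPos t b c x = skipValue c (skipValue b (sortedRank t x)) := by
  rw [insertedPos, if_neg hxt, if_neg hx₀]

lemma sortedLabel_lt {t i : ℕ} (ht : 1 ≤ t) (hi : i < 3 * t - 2) : sortedLabel t i < 3 * t := by
  unfold sortedLabel; split_ifs <;> omega

lemma exists_sortedLabel_eq {t x : ℕ} (hx : x < 3 * t) (hx₀ : x ≠ 0) (hxt : x ≠ t) :
    ∃ i, i < 3 * t - 2 ∧ sortedLabel t i = x := by
  refine ⟨sortedRank t x, ?_, ?_⟩
  · unfold sortedRank; split_ifs <;> omega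
  · unfold sortedLabel sortedRank; split_ifs <;> omega

lemma sortedLabel_ne {t i : ℕ} (ht : 1 ≤ t) (hi : i < 3 * t - 2) :
    sortedLabel t i ≠ 0 ∧ sortedLabel t i ≠ t := by
  unfold sortedLabel; split_ifs <;> omega

lemma labelPos_sortedLabel_lt {t : ℕ} {q : ℕ → ℕ} (h : RespectsThreeRows t q)
    (hs : IsAlmostSorted t q) {i j : ℕ} (hij : i < j) (hj : j < 3 * t - 2) :
    q (sortedLabel t i) < q (sortedLabel t j) := by
  unfold sortedLabel
  split_ifs with h₁ h₂ h₃ h₄ h₅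
  · exact h.top _ _ (by omega) (by omega) (by omega)
  · exact hs.top_mid _ _ (by omega) (by omega) (by omega) (by omega)
  · have h₆ := hs.mid_low (t + i) (j + 2 - 2 * t) (by omega) (by omega) (by omega) (by omega)
    have h₇ := h.col (t + i) (by omega)
    rw [show t + i + t = 2 * t + i by omega] at h₇
    omega
  all_goals first
    | omega
    | exact h.mid _ _ (by omega) (by omega) (by omega)
    | exact hs.mid_low _ _ (by omega) (by omega) (by omega) (by omega)
    | exact h.low _ _ (by omega) (by omega)

lemma eq_of_labelPos_eq {t : ℕ} (ht : 1 ≤ t) {v w : Equiv.Perm (Fin (3 * t))}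
    (hv : RespectsThreeRows t (labelPos v)) (hvs : IsAlmostSorted t (labelPos v))
    (hw : RespectsThreeRows t (labelPos w)) (hws : IsAlmostSorted t (labelPos w))
    (hmid : labelPos v t = labelPos w t) (hlow : labelPos v 0 = labelPos w 0) : v = w := by
  let g (u : Equiv.Perm (Fin (3 * t))) (i : Fin (3 * t - 2)) : Fin (3 * t) :=
    u.symm ⟨sortedLabel t i, sortedLabel_lt ht i.isLt⟩
  have hmono : ∀ u : Equiv.Perm (Fin (3 * t)), RespectsThreeRows t (labelPos u) →
      IsAlmostSorted t (labelPos u) → StrictMono (g u) := by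
    intro u hu hus i j hij
    have := labelPos_sortedLabel_lt hu hus hij j.isLt
    rwa [labelPos_of_lt u (sortedLabel_lt ht i.isLt),
      labelPos_of_lt u (sortedLabel_lt ht j.isLt)] at this
  have hrange : ∀ u : Equiv.Perm (Fin (3 * t)),
      Set.range (g u) = {y : Fin (3 * t) | (y : ℕ) ≠ labelPos u t ∧ (y : ℕ) ≠ labelPos u 0} := by
    intro u
    ext y
    constructor
    · rintro ⟨i, rfl⟩
      have hne := sortedLabel_ne ht i.isLt
      have hlt := sortedLabel_lt ht i.isLt
      have hg : (g u i : ℕ) = labelPos u (sortedLabel t i) := (labelPos_of_lt u hlt).symm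
      rw [Set.mem_ofPred_eq, hg]
      exact ⟨fun e => hne.2 (labelPos_inj u hlt (by omega) e),
        fun e => hne.1 (labelPos_inj u hlt (by omega) e)⟩
    · rintro ⟨h₁, h₂⟩
      have key : labelPos u (u y) = y := by simp [labelPos_val]
      obtain ⟨i, hi, he⟩ := exists_sortedLabel_eq (u y).isLt
        (fun e => h₂ (by rw [← e, key])) (fun e => h₁ (by rw [← key, e]))
      exact ⟨⟨i, hi⟩, by simp [g, he]⟩
  have hg : g v = g w :=
    Set.range_injOn_strictMono (hmono v hv hvs) (hmono w hw hws)
      (by rw [hrange, hrange, hmid, hlow])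
  rw [← Equiv.symm_bijective.injective.eq_iff]
  ext x
  rw [← labelPos_val, ← labelPos_val]
  by_cases hx₀ : (x : ℕ) = 0
  · rw [hx₀, hlow]
  by_cases hxt : (x : ℕ) = t
  · rw [hxt, hmid]
  obtain ⟨i, hi, he⟩ := exists_sortedLabel_eq x.isLt hx₀ hxt
  have := congrArg Fin.val (congrFun hg ⟨i, hi⟩)
  simpa [g, he, labelPos_val] using this

lemma labelPos_le_of_forall_lt {n m : ℕ} (w : Equiv.Perm (Fin n)) {a : ℕ} (ha : a < n)
    (hm : m ≤ n) (h : ∀ x < m, labelPos w a ≤ labelPos w x) : labelPos w a ≤ n - m := by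
  have hcard : (Finset.univ.filter fun x : Fin n => (x : ℕ) < m).card ≤
      (Finset.Ico (labelPos w a) n).card := by
    refine Finset.card_le_card_of_injOn (fun x => labelPos w x) ?_ ?_
    · intro x hx
      simp only [Finset.coe_filter, Finset.mem_univ, true_and, Set.mem_ofPred_eq] at hx
      simp only [Finset.coe_Ico, Set.mem_Ico]
      exact ⟨h x hx, labelPos_lt w x.isLt⟩
    · intro x _ y _ e
      exact Fin.ext (labelPos_inj w x.isLt y.isLt e)
  rw [Nat.card_Ico, Fin.card_filter_val_lt, min_eq_right hm] at hcard
  have := labelPos_lt w ha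
  omega

/-- The admissible positions of the labels `t` and `0`. -/
def insertionPairs (t : ℕ) : Finset (Σ _ : ℕ, ℕ) :=
  (Finset.Icc 1 t).sigma fun b => Finset.Ioc b (2 * t)

lemma card_insertionPairs (t : ℕ) : (insertionPairs t).card = t * (3 * t - 1) / 2 := by
  have hsum : ∀ m, m ≤ 2 * t → 2 * ∑ b ∈ Finset.Icc 1 m, (2 * t - b) + m * (m + 1) = 4 * t * m := by
    intro m
    induction m with
    | zero => simp
    | succ m ih =>
      intro hm
      rw [Finset.sum_Icc_succ_top (by omega)]
      have := ih (by omega)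
      zify [hm] at this ⊢
      linarith
  have h := hsum t (by omega)
  simp only [insertionPairs, Finset.card_sigma, Nat.card_Ioc]
  rcases Nat.eq_zero_or_pos t with rfl | ht
  · simp
  symm
  apply Nat.div_eq_of_eq_mul_right (by norm_num)
  zify [show 1 ≤ 3 * t by omega] at h ⊢
  linarith

lemma mem_insertionPairs {t : ℕ} (ht : 1 ≤ t) {w : Equiv.Perm (Fin (3 * t))}
    (h : RespectsThreeRows t (labelPos w)) :
    (⟨labelPos w t, labelPos w 0⟩ : Σ _ : ℕ, ℕ) ∈ insertionPairs t := by
  have htt := h.col t (by omega)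
  have ht₀ := h.col 0 (by omega)
  rw [zero_add] at ht₀
  have hle₀ : ∀ x < t, labelPos w 0 ≤ labelPos w x := by
    intro x hx
    rcases Nat.eq_zero_or_pos x with rfl | hx₀
    · exact le_rfl
    · exact (h.low 0 x hx₀ hx).le
  have hc := labelPos_le_of_forall_lt w (show 0 < 3 * t by omega) (show t ≤ 3 * t by omega) hle₀
  have hb := labelPos_le_of_forall_lt w (show t < 3 * t by omega) (show 2 * t ≤ 3 * t by omega)
    (fun x hx => by
      rcases lt_trichotomy x t with hxt | rfl | hxt
      · have := hle₀ x hxt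
        omega
      · exact le_rfl
      · exact (h.mid t x le_rfl hxt hx).le)
  simp only [insertionPairs, Finset.mem_sigma, Finset.mem_Icc, Finset.mem_Ioc]
  omega

lemma insertedPos_self (t b c : ℕ) : insertedPos t b c t = b := if_pos rfl

lemma insertedPos_zero {t b c : ℕ} (ht : t ≠ 0) : insertedPos t b c 0 = c := by
  rw [insertedPos, if_neg ht.symm, if_pos rfl]

lemma insertedPos_lt {t b c x : ℕ} (hb : b ≤ t) (hbc : b < c) (hc : c ≤ 2 * t) (hx : x < 3 * t) :
    insertedPos t b c x < 3 * t := by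
  unfold insertedPos
  split_ifs with hxt hx₀
  · omega
  · omega
  · have h : sortedRank t x < 3 * t - 2 := by
      unfold sortedRank; split_ifs <;> omega
    unfold skipValue
    split_ifs <;> omega

lemma insertedPos_injOn {t b c x y : ℕ} (hbc : b < c) (hx : x < 3 * t) (hy : y < 3 * t)
    (h : insertedPos t b c x = insertedPos t b c y) : x = y := by
  have hb : ∀ r, skipValue c (skipValue b r) ≠ b := fun r => by
    have hr := skipValue_ne b r
    generalize skipValue b r = s at hr
    unfold skipValue
    split_ifs <;> omega
  have hc : ∀ r, skipValue c (skipValue b r) ≠ c := fun r => skipValue_ne c _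
  unfold insertedPos at h
  split_ifs at h with h₁ h₂ h₃ h₄ h₅ h₆ h₇ h₈
  any_goals omega
  · exact absurd h.symm (hb _)
  · exact absurd h.symm (hc _)
  · exact absurd h (hb _)
  · exact absurd h (hc _)
  · have hr := (skipValue_strictMono b).injective ((skipValue_strictMono c).injective h)
    unfold sortedRank at hr
    split_ifs at hr <;> omega

lemma exists_labelPos_eq_insertedPos {t b c : ℕ} (hb : b ≤ t) (hbc : b < c) (hc : c ≤ 2 * t) :
    ∃ w : Equiv.Perm (Fin (3 * t)), ∀ x < 3 * t, labelPos w x = insertedPos t b c x := by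
  let f : Fin (3 * t) → Fin (3 * t) := fun x =>
    ⟨insertedPos t b c x, insertedPos_lt hb hbc hc x.isLt⟩
  have hinj : Function.Injective f := fun x y hxy =>
    Fin.ext (insertedPos_injOn hbc x.isLt y.isLt (congrArg Fin.val hxy))
  refine ⟨(Equiv.ofBijective f (Finite.injective_iff_bijective.1 hinj)).symm, fun x hx => ?_⟩
  rw [labelPos_of_lt _ hx]
  rfl

lemma insertedPos_lt_of_sortedRank_lt {t b c x y : ℕ} (hxt : x ≠ t) (hx₀ : x ≠ 0) (hyt : y ≠ t)
    (hy₀ : y ≠ 0) (h : sortedRank t x < sortedRank t y) :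
    insertedPos t b c x < insertedPos t b c y := by
  rw [insertedPos_of_ne hxt hx₀, insertedPos_of_ne hyt hy₀]
  exact skipValue_strictMono c (skipValue_strictMono b h)

lemma insertedPos_respectsThreeRows {t b c : ℕ} (hb₁ : 1 ≤ b) (hb : b ≤ t) (hbc : b < c)
    (hc : c ≤ 2 * t) : RespectsThreeRows t (insertedPos t b c) := by
  refine ⟨fun x y hxy hy => ?_, fun x y hx hxy hy => ?_, fun x y hx hxy hy => ?_,
    fun x hx => ?_⟩
  · rcases Nat.eq_zero_or_pos x with rfl | hx₀
    · rw [insertedPos_zero (by omega), insertedPos_of_ne (by omega) (by omega)]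
      unfold skipValue sortedRank
      split_ifs <;> omega
    · apply insertedPos_lt_of_sortedRank_lt <;> (try unfold sortedRank) <;> (try split_ifs) <;>
        omega
  · rcases eq_or_lt_of_le hx with rfl | hxt
    · rw [insertedPos_self, insertedPos_of_ne (by omega) (by omega)]
      unfold skipValue sortedRank
      split_ifs <;> omega
    · apply insertedPos_lt_of_sortedRank_lt <;> (try unfold sortedRank) <;> (try split_ifs) <;>
        omega
  · apply insertedPos_lt_of_sortedRank_lt <;> (try unfold sortedRank) <;> (try split_ifs) <;>
      omega
  · rcases Nat.eq_zero_or_pos x with rfl | hx₀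
    · rwa [zero_add, insertedPos_self, insertedPos_zero (by omega)]
    rcases eq_or_ne x t with rfl | hxt
    · rw [insertedPos_self, insertedPos_of_ne (by omega) (by omega)]
      unfold skipValue sortedRank
      split_ifs <;> omega
    · apply insertedPos_lt_of_sortedRank_lt <;> (try unfold sortedRank) <;> (try split_ifs) <;>
        omega

lemma insertedPos_isAlmostSorted {t b c : ℕ} (hb : b ≤ t) (hbc : b < c) :
    IsAlmostSorted t (insertedPos t b c) := by
  refine ⟨fun x y hx hx' hy hy' => ?_, fun x y hx hx' hy hy' => ?_⟩
  · apply insertedPos_lt_of_sortedRank_lt <;> (try unfold sortedRank) <;> (try split_ifs) <;>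
      omega
  · rcases eq_or_lt_of_le hx with rfl | hxt
    · rw [insertedPos_self, insertedPos_of_ne (by omega) (by omega)]
      unfold skipValue sortedRank
      split_ifs <;> omega
    · apply insertedPos_lt_of_sortedRank_lt <;> (try unfold sortedRank) <;> (try split_ifs) <;>
        omega

lemma RespectsThreeRows.congr {t : ℕ} {p q : ℕ → ℕ} (hpq : ∀ x < 3 * t, p x = q x)
    (h : RespectsThreeRows t q) : RespectsThreeRows t p := by
  refine ⟨fun a b hab hb => ?_, fun a b ha hab hb => ?_, fun a b ha hab hb => ?_,
    fun a ha => ?_⟩ <;> rw [hpq _ (by omega), hpq _ (by omega)]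
  · exact h.low a b hab hb
  · exact h.mid a b ha hab hb
  · exact h.top a b ha hab hb
  · exact h.col a ha

lemma IsAlmostSorted.congr {t : ℕ} {p q : ℕ → ℕ} (hpq : ∀ x < 3 * t, p x = q x)
    (h : IsAlmostSorted t q) : IsAlmostSorted t p := by
  refine ⟨fun a b ha ha' hb hb' => ?_, fun a b ha ha' hb hb' => ?_⟩ <;>
    rw [hpq _ (by omega), hpq _ (by omega)]
  · exact h.top_mid a b ha ha' hb hb'
  · exact h.mid_low a b ha ha' hb hb'

/-- For all `t ≥ 1`, the number of linear extensions of `N_{3,t}` avoiding `1243`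
is `t(3t−1)/2`. -/
theorem card_three_t_1243 (t : ℕ) (ht : 1 ≤ t) :
    Nat.card {w : Equiv.Perm (Fin (3 * t)) // IsLinExtN 3 t w ∧ ¬ PermContains w pat1243} =
      t * (3 * t - 1) / 2 := by
  have hiff : ∀ w : Equiv.Perm (Fin (3 * t)), (IsLinExtN 3 t w ∧ ¬ PermContains w pat1243) ↔
      RespectsThreeRows t (labelPos w) ∧ IsAlmostSorted t (labelPos w) := fun w => by
    rw [isLinExtN_three_iff]
    exact and_congr_right fun h => (isAlmostSorted_iff_avoids h).symm
  let F (w : {w : Equiv.Perm (Fin (3 * t)) // IsLinExtN 3 t w ∧ ¬ PermContains w pat1243}) :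
      insertionPairs t :=
    ⟨⟨labelPos w.1 t, labelPos w.1 0⟩, mem_insertionPairs ht ((hiff w.1).1 w.2).1⟩
  have hF : Function.Bijective F := by
    constructor
    · rintro ⟨v, hv⟩ ⟨w, hw⟩ h
      simp only [F, Subtype.mk.injEq, Sigma.mk.injEq, heq_eq_eq] at h
      obtain ⟨hv₁, hv₂⟩ := (hiff v).1 hv
      obtain ⟨hw₁, hw₂⟩ := (hiff w).1 hw
      exact Subtype.ext (eq_of_labelPos_eq ht hv₁ hv₂ hw₁ hw₂ h.1 h.2)
    · rintro ⟨⟨b, c⟩, h⟩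
      have h' := h
      simp only [insertionPairs, Finset.mem_sigma, Finset.mem_Icc, Finset.mem_Ioc] at h'
      obtain ⟨⟨hb₁, hb⟩, hbc, hc⟩ := h'
      obtain ⟨w, hw⟩ := exists_labelPos_eq_insertedPos hb hbc hc
      refine ⟨⟨w, (hiff w).2 ⟨(insertedPos_respectsThreeRows hb₁ hb hbc hc).congr hw,
        (insertedPos_isAlmostSorted hb hbc).congr hw⟩⟩, ?_⟩
      have hwt : labelPos w t = b := by
        rw [hw t (by omega), insertedPos_self]
      have hw₀ : labelPos w 0 = c := by
        rw [hw 0 (by omega), insertedPos_zero (by omega)]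
      simp [F, hwt, hw₀]
  rw [Nat.card_congr (Equiv.ofBijective F hF), Nat.card_eq_fintype_card, Fintype.card_coe,
    card_insertionPairs]
end
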